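/- The su_q^P(3) coproduct respects the simple-root ladder brackets: as functions on ℝ⁹×ℝ⁹ one has {Δ(a₁₂), Δ(a₂₁)} = sinh(z((h₁+h₁')−(h₂+h₂')))/z and {Δ(a₂₃), Δ(a₃₂)} = sinh(z((h₂+h₂')−(h₃+h₃')))/z, where the brackets on the left are the product Poisson bracket. -/

import Mathlib

/-- Partial derivative of a function on ℝ⁹ in the `i`-th coordinate direction.
Coordinates: (x 0,…,x 8) = (h₁,h₂,h₃,a₁₂,a₂₁,a₂₃,a₃₂,a₁₃,a₃₁). -/
noncomputable def pd (i : Fin 9) (f : (Fin 9 → ℝ) → ℝ) (x : Fin 9 → ℝ) : ℝ :=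
  fderiv ℝ f x (Pi.single i 1)

/-- The structure functions π(u,v) of su_q^P(3) for u < v (zero otherwise);
indices: 0=h₁, 1=h₂, 2=h₃, 3=a₁₂, 4=a₂₁, 5=a₂₃, 6=a₃₂, 7=a₁₃, 8=a₃₁. -/
noncomputable def piU (z : ℝ) (u v : ℕ) (x : Fin 9 → ℝ) : ℝ :=
  match u, v with
  | 0, 3 => x 3
  | 0, 4 => -x 4
  | 0, 7 => x 7
  | 0, 8 => -x 8
  | 1, 3 => -x 3
  | 1, 4 => x 4
  | 1, 5 => x 5
  | 1, 6 => -x 6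
  | 2, 5 => -x 5
  | 2, 6 => x 6
  | 2, 7 => -x 7
  | 2, 8 => x 8
  | 3, 4 => Real.sinh (z * (x 0 - x 1)) / z
  | 3, 5 => x 7
  | 3, 7 => z ^ 2 * x 3 ^ 2 * x 5
  | 3, 8 => -(Real.cosh (z * (x 0 - x 1)) * x 6)
  | 4, 6 => -x 8
  | 4, 7 => Real.cosh (z * (x 0 - x 1)) * x 5
  | 4, 8 => -(z ^ 2 * x 4 ^ 2 * x 6)
  | 5, 6 => Real.sinh (z * (x 1 - x 2)) / z
  | 5, 7 => -(z ^ 2 * x 5 ^ 2 * x 3)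
  | 5, 8 => Real.cosh (z * (x 1 - x 2)) * x 4
  | 6, 7 => -(Real.cosh (z * (x 1 - x 2)) * x 3)
  | 6, 8 => z ^ 2 * x 6 ^ 2 * x 4
  | 7, 8 => Real.sinh (z * (x 0 - x 2)) / z
      + z * Real.sinh (z * (x 0 - x 1)) * x 5 * x 6
      + z * Real.sinh (z * (x 1 - x 2)) * x 3 * x 4
  | _, _ => 0

/-- The bracket of the q-Poisson algebra su_q^P(3):
{f,g} = Σ_{u<v} π(u,v)(∂_u f ∂_v g − ∂_v f ∂_u g). -/
noncomputable def suq3Bracket (z : ℝ) (f g : (Fin 9 → ℝ) → ℝ) (x : Fin 9 → ℝ) : ℝ :=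
  ∑ u : Fin 9, ∑ v : Fin 9,
    if u < v then piU z u.val v.val x * (pd u f x * pd v g x - pd v f x * pd u g x)
    else 0

/-- The product Poisson bracket on ℝ⁹ × ℝ⁹. -/
noncomputable def suq3Bracket2 (z : ℝ) (F G : (Fin 9 → ℝ) × (Fin 9 → ℝ) → ℝ)
    (p : (Fin 9 → ℝ) × (Fin 9 → ℝ)) : ℝ :=
  suq3Bracket z (fun y => F (y, p.2)) (fun y => G (y, p.2)) p.1
  + suq3Bracket z (fun y => F (p.1, y)) (fun y => G (p.1, y)) p.2

/-- Coproduct Δ(hᵢ) = hᵢ + hᵢ' (i = 0,1,2 standing for 1,2,3). -/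
noncomputable def Dh (i : Fin 3) : (Fin 9 → ℝ) × (Fin 9 → ℝ) → ℝ := fun p =>
  p.1 ⟨i.val, by omega⟩ + p.2 ⟨i.val, by omega⟩

/-- Coproduct Δ(a₁₂). -/
noncomputable def Da12 (z : ℝ) : (Fin 9 → ℝ) × (Fin 9 → ℝ) → ℝ := fun p =>
  Real.exp (z * (p.1 0 - p.1 1) / 2) * p.2 3
  + p.1 3 * Real.exp (-(z * (p.2 0 - p.2 1) / 2))

/-- Coproduct Δ(a₂₁). -/
noncomputable def Da21 (z : ℝ) : (Fin 9 → ℝ) × (Fin 9 → ℝ) → ℝ := fun p =>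
  Real.exp (z * (p.1 0 - p.1 1) / 2) * p.2 4
  + p.1 4 * Real.exp (-(z * (p.2 0 - p.2 1) / 2))

/-- Coproduct Δ(a₂₃). -/
noncomputable def Da23 (z : ℝ) : (Fin 9 → ℝ) × (Fin 9 → ℝ) → ℝ := fun p =>
  Real.exp (z * (p.1 1 - p.1 2) / 2) * p.2 5
  + p.1 5 * Real.exp (-(z * (p.2 1 - p.2 2) / 2))

/-- Coproduct Δ(a₃₂). -/
noncomputable def Da32 (z : ℝ) : (Fin 9 → ℝ) × (Fin 9 → ℝ) → ℝ := fun p =>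
  Real.exp (z * (p.1 1 - p.1 2) / 2) * p.2 6
  + p.1 6 * Real.exp (-(z * (p.2 1 - p.2 2) / 2))

/-- Coproduct Δ(a₁₃). -/
noncomputable def Da13 (z : ℝ) : (Fin 9 → ℝ) × (Fin 9 → ℝ) → ℝ := fun p =>
  Real.exp (z * (p.1 0 - p.1 2) / 2) * p.2 7
  + p.1 7 * Real.exp (-(z * (p.2 0 - p.2 2) / 2))
  + z * (Real.exp (z * (p.1 1 - p.1 2) / 2) * p.1 3
           * (Real.exp (-(z * (p.2 0 - p.2 1) / 2)) * p.2 5)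
         - Real.exp (z * (p.1 0 - p.1 1) / 2) * p.1 5
           * (Real.exp (-(z * (p.2 1 - p.2 2) / 2)) * p.2 3))

/-- Coproduct Δ(a₃₁). -/
noncomputable def Da31 (z : ℝ) : (Fin 9 → ℝ) × (Fin 9 → ℝ) → ℝ := fun p =>
  Real.exp (z * (p.1 0 - p.1 2) / 2) * p.2 8
  + p.1 8 * Real.exp (-(z * (p.2 0 - p.2 2) / 2))
  + z * (Real.exp (z * (p.1 1 - p.1 2) / 2) * p.1 4
           * (Real.exp (-(z * (p.2 0 - p.2 1) / 2)) * p.2 6)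
         - Real.exp (z * (p.1 0 - p.1 1) / 2) * p.1 6
           * (Real.exp (-(z * (p.2 1 - p.2 2) / 2)) * p.2 4))

/-- Partial derivatives of `exp (s (yᵢ - yⱼ)) c + yₖ d`. -/
theorem pd_exp_mul_add (s c d : ℝ) (i j k m : Fin 9) (x : Fin 9 → ℝ) :
    pd m (fun y => Real.exp (s * (y i - y j)) * c + y k * d) x
      = Real.exp (s * (x i - x j)) * (s * ((if i = m then 1 else 0) - (if j = m then 1 else 0))) * c
        + (if k = m then 1 else 0) * d := by
  have h (l : Fin 9) : HasFDerivAt (fun y : Fin 9 → ℝ => y l)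
      (ContinuousLinearMap.proj (R := ℝ) (φ := fun _ : Fin 9 => ℝ) l) x := hasFDerivAt_apply l x
  have hf := (((((h i).sub (h j)).const_mul s).exp).mul_const c).add ((h k).mul_const d)
  unfold pd
  erw [hf.fderiv]
  simp [Pi.single_apply]
  ring

/-- The bracket of two exponential-plus-linear functions along the first simple root. -/
theorem suq3Bracket_exp_simple_root_one (z s c c' d d' : ℝ) (x : Fin 9 → ℝ) :
    suq3Bracket z (fun y => Real.exp (s * (y 0 - y 1)) * c + y 3 * d)
        (fun y => Real.exp (s * (y 0 - y 1)) * c' + y 4 * d') x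
      = Real.sinh (z * (x 0 - x 1)) / z * (d * d')
        - 2 * s * Real.exp (s * (x 0 - x 1)) * (x 3 * (d * c') + x 4 * (c * d')) := by
  simp only [suq3Bracket, pd_exp_mul_add]
  simp [Fin.sum_univ_succ, piU]
  ring

/-- The bracket of two exponential-plus-linear functions along the second simple root. -/
theorem suq3Bracket_exp_simple_root_two (z s c c' d d' : ℝ) (x : Fin 9 → ℝ) :
    suq3Bracket z (fun y => Real.exp (s * (y 1 - y 2)) * c + y 5 * d)
        (fun y => Real.exp (s * (y 1 - y 2)) * c' + y 6 * d') x
      = Real.sinh (z * (x 1 - x 2)) / z * (d * d')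
        - 2 * s * Real.exp (s * (x 1 - x 2)) * (x 5 * (d * c') + x 6 * (c * d')) := by
  simp only [suq3Bracket, pd_exp_mul_add]
  simp [Fin.sum_univ_succ, piU]
  ring

/-- Addition formula for `sinh` in terms of half-argument exponentials. -/
theorem sinh_mul_exp_half_add (u v : ℝ) :
    Real.sinh u * (Real.exp (-(v / 2)) * Real.exp (-(v / 2)))
      + Real.sinh v * (Real.exp (u / 2) * Real.exp (u / 2)) = Real.sinh (u + v) := by
  rw [← Real.exp_add, ← Real.exp_add, Real.sinh_add, ← neg_add, add_halves, add_halves,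
    ← Real.cosh_add_sinh u, ← Real.cosh_sub_sinh v]
  ring

/-- the su_q^P(3) coproduct respects the simple-root ladder
brackets. -/
theorem suq3_coproduct_ladder (z : ℝ) (hz : z ≠ 0) :
    (∀ p : (Fin 9 → ℝ) × (Fin 9 → ℝ),
      suq3Bracket2 z (Da12 z) (Da21 z) p
        = Real.sinh (z * ((p.1 0 + p.2 0) - (p.1 1 + p.2 1))) / z) ∧
    (∀ p : (Fin 9 → ℝ) × (Fin 9 → ℝ),
      suq3Bracket2 z (Da23 z) (Da32 z) p
        = Real.sinh (z * ((p.1 1 + p.2 1) - (p.1 2 + p.2 2))) / z) := by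
  have hl (t : ℝ) : z * t / 2 = z / 2 * t := by ring
  have hr (t : ℝ) : -(z / 2 * t) = -(z / 2) * t := by ring
  have hswap (A b : ℝ) (i j k : Fin 9) :
      (fun y : Fin 9 → ℝ => A * y k + b * Real.exp (-(z / 2) * (y i - y j)))
        = fun y => Real.exp (-(z / 2) * (y i - y j)) * b + y k * A := by
    funext y
    ring
  refine ⟨fun p => ?_, fun p => ?_⟩
  · have hs : z * ((p.1 0 + p.2 0) - (p.1 1 + p.2 1))
        = z * (p.1 0 - p.1 1) + z * (p.2 0 - p.2 1) := by ring
    rw [hs, ← sinh_mul_exp_half_add]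
    simp only [suq3Bracket2, Da12, Da21, hl, hr]
    rw [suq3Bracket_exp_simple_root_one, hswap, hswap, suq3Bracket_exp_simple_root_one]
    ring
  · have hs : z * ((p.1 1 + p.2 1) - (p.1 2 + p.2 2))
        = z * (p.1 1 - p.1 2) + z * (p.2 1 - p.2 2) := by ring
    rw [hs, ← sinh_mul_exp_half_add]
    simp only [suq3Bracket2, Da23, Da32, hl, hr]
    rw [suq3Bracket_exp_simple_root_two, hswap, hswap, suq3Bracket_exp_simple_root_two]
    ring
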